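/- Let F be a finite field, K = LaurentSeries F, t = single 1 1 ∈ K, and R ⊆ K the image of the power series ring F[[X]] in K. Then there exists a bijection from (R × R) ∖ {(0,0)} onto R × R whose graph, viewed as a subset of K⁴ (encoded as Set (Fin 4 → K)), is definable in the first-order language of rings with parameters from {t}. -/

import Mathlib

open FirstOrder

noncomputable instance (F : Type*) [Field F] :
    FirstOrder.Ring.CompatibleRing (LaurentSeries F) :=
  FirstOrder.Ring.compatibleRingOfRing _

/-- `O` is a subring of `K` that behaves like a discrete valuation ring with uniformizer `t`, and
`X` behaves like the set of nonzero elements of `O` with angular component `1`. -/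
structure IsAngularSet {K : Type*} [Field K] (O : Subring K) (t : K) (X : Set K) : Prop where
  mem : t ∈ O
  inv_notMem : t⁻¹ ∉ O
  mem_or_inv_mem : ∀ x, x ∈ O ∨ (t * x)⁻¹ ∈ O
  subset : ∀ x ∈ X, x ∈ O
  zero_notMem : (0 : K) ∉ X
  mem_of_sub_one : ∀ x, (x - 1) / t ∈ O → x ∈ X
  div_mem_or : ∀ x ∈ X, x / t ∈ O ∨ (x - 1) / t ∈ O
  mul_mem : ∀ x ∈ X, t * x ∈ X
  mem_of_mul : ∀ x ∈ O, t * x ∈ X → x ∈ X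

open Classical in
/-- A map restricting to a bijection from `O × O` without the origin onto `O × O`. -/
noncomputable def fillOrigin {K : Type*} [Field K] (O : Set K) (t : K) (X : Set K)
    (z : K × K) : K × K :=
  if z.1 = 0 then
    if z.2 = 1 then (0, 0)
    else if z.2 ∈ X ∧ z.2 / t ∈ O then (0, z.2 / t)
    else if (z.2 - 1) / t ∈ O then (z.2 - 1, 1)
    else z
  else if z.1 / t ∈ O then
    if z.2 ∈ X then (z.1, t * z.2) else z
  else if z.1 ≠ 1 ∧ (z.1 - 1) / t ∈ O then
    if z.2 / ((z.1 - 1) / t) ∈ O then (z.1, z.2 / ((z.1 - 1) / t))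
    else (t * z.2, 1 + (z.1 - 1) / t / z.2)
  else z

open Classical in
/-- The inverse of `fillOrigin`. -/
noncomputable def removeOrigin {K : Type*} [Field K] (O : Set K) (t : K) (X : Set K)
    (z : K × K) : K × K :=
  if z.1 = 0 then
    if z.2 = 0 then (0, 1) else if z.2 ∈ X then (0, t * z.2) else z
  else if z.1 / t ∈ O then
    if z.2 = 1 then (0, 1 + z.1)
    else if z.2 ∈ X then
      if z.2 / t ∈ O then (z.1, z.2 / t) else (1 + z.1 * (z.2 - 1), z.1 / t)
    else z
  else if z.1 ≠ 1 ∧ (z.1 - 1) / t ∈ O then (z.1, (z.1 - 1) / t * z.2)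
  else z

namespace IsAngularSet

variable {K : Type*} [Field K] {O : Subring K} {t : K} {X : Set K}

theorem ne_zero (h : IsAngularSet O t X) : t ≠ 0 := by
  rintro rfl
  exact h.inv_notMem (by simp)

theorem mem_of_div (h : IsAngularSet O t X) {x : K} (hx : x / t ∈ O) : x ∈ O := by
  simpa [mul_div_cancel₀ _ h.ne_zero] using O.mul_mem h.mem hx

theorem mem_of_sub_one_div (h : IsAngularSet O t X) {x : K} (hx : (x - 1) / t ∈ O) : x ∈ O := by
  simpa using O.add_mem (h.mem_of_div hx) O.one_mem

theorem sub_one_div_notMem (h : IsAngularSet O t X) {x : K} (hx : x / t ∈ O) :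
    (x - 1) / t ∉ O := fun h' => h.inv_notMem (by
  have := O.sub_mem hx h'
  rwa [← sub_div, sub_sub_cancel, one_div] at this)

theorem div_notMem_iff (h : IsAngularSet O t X) {x y : K} (hx : x ≠ 0) (hy : y ≠ 0) :
    y / x ∉ O ↔ x / y / t ∈ O := by
  have ht := h.ne_zero
  have e : (t * (y / x))⁻¹ = x / y / t := by field_simp
  constructor
  · intro h'
    simpa [e] using (h.mem_or_inv_mem (y / x)).resolve_left h'
  · intro h1 h2
    have := O.mul_mem h1 h2
    refine h.inv_notMem ?_
    convert this using 1
    field_simp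

theorem one_mem (h : IsAngularSet O t X) : (1 : K) ∈ X := h.mem_of_sub_one 1 (by simp)

theorem mapsTo_fillOrigin (h : IsAngularSet O t X) :
    Set.MapsTo (fillOrigin O t X) (((O : Set K) ×ˢ (O : Set K)) \ {(0, 0)})
      ((O : Set K) ×ˢ (O : Set K)) := by
  rintro ⟨u, v⟩ ⟨⟨hu, hv⟩, -⟩
  have ht := h.ne_zero
  simp only [SetLike.mem_coe] at hu hv
  have key : (u - 1) / t ∈ O → u ≠ 1 → v / ((u - 1) / t) ∉ O → (u - 1) / t / v ∈ O := by
    intro h1 h2 h3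
    have hv0 : v ≠ 0 := by rintro rfl; simp at h3
    exact h.mem_of_div ((h.div_notMem_iff (div_ne_zero (sub_ne_zero.2 h2) ht) hv0).1 h3)
  have := O.one_mem
  have := O.zero_mem
  have := h.mem
  unfold fillOrigin
  simp only [SetLike.mem_coe]
  split_ifs <;>
    simp_all [O.mul_mem, O.add_mem, O.sub_mem]

theorem mapsTo_removeOrigin (h : IsAngularSet O t X) :
    Set.MapsTo (removeOrigin O t X) ((O : Set K) ×ˢ (O : Set K))
      (((O : Set K) ×ˢ (O : Set K)) \ {(0, 0)}) := by
  rintro ⟨u, v⟩ ⟨hu, hv⟩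
  have ht := h.ne_zero
  simp only [SetLike.mem_coe] at hu hv
  have hadd : u / t ∈ O → 1 + u ≠ 0 := fun h1 h2 =>
    h.sub_one_div_notMem (x := 1 + u) (by simp [h2]) (by simpa using h1)
  have hmul : 1 + u * (v - 1) ∈ O :=
    O.add_mem O.one_mem (O.mul_mem hu (O.sub_mem hv O.one_mem))
  have := O.one_mem
  have := O.zero_mem
  have := h.mem
  unfold removeOrigin
  simp only [SetLike.mem_coe]
  split_ifs <;>
    simp_all [O.mul_mem, O.add_mem]

theorem leftInvOn (h : IsAngularSet O t X) :
    Set.LeftInvOn (removeOrigin O t X) (fillOrigin O t X)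
      (((O : Set K) ×ˢ (O : Set K)) \ {(0, 0)}) := by
  rintro ⟨u, v⟩ ⟨⟨hu, hv⟩, h00⟩
  have ht := h.ne_zero
  have h0 := h.zero_notMem
  have h1 := h.one_mem
  simp only [SetLike.mem_coe] at hu hv
  by_cases u0 : u = 0
  · subst u0
    by_cases v1 : v = 1
    · simp [fillOrigin, removeOrigin, v1]
    by_cases v2 : v ∈ X ∧ v / t ∈ O
    · have v0 : v ≠ 0 := by rintro rfl; exact h0 v2.1
      have : v / t ∈ X := h.mem_of_mul _ v2.2 (by rw [mul_div_cancel₀ _ ht]; exact v2.1)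
      simp [fillOrigin, removeOrigin, v1, v2, v0, ht, this, mul_div_cancel₀]
    by_cases v3 : (v - 1) / t ∈ O
    · simp [fillOrigin, removeOrigin, v1, v2, v3, sub_ne_zero.2 v1]
    · have vX : v ∉ X := fun hx => (h.div_mem_or v hx).elim (fun h => v2 ⟨hx, h⟩) v3
      have : v ≠ 0 := by simpa using h00
      simp [fillOrigin, removeOrigin, v1, v3, this, vX]
  by_cases u1 : u / t ∈ O
  · by_cases vX : v ∈ X
    · have : t * v ≠ 1 := fun h' => h.inv_notMem (by rwa [← eq_inv_of_mul_eq_one_right h'])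
      simp [fillOrigin, removeOrigin, u0, u1, vX, this, h.mul_mem, ht, hv]
    · have : v ≠ 1 := by rintro rfl; exact vX h1
      simp [fillOrigin, removeOrigin, u0, u1, vX, this]
  by_cases u2 : u ≠ 1 ∧ (u - 1) / t ∈ O
  · have u3 := sub_ne_zero.2 u2.1
    by_cases v1 : v / ((u - 1) / t) ∈ O
    · simp only [fillOrigin, removeOrigin, u0, u1, u2, v1, SetLike.mem_coe, if_true, if_false,
        ne_eq, not_false_eq_true, and_self]
      rw [mul_div_cancel₀ _ (div_ne_zero u3 ht)]
    · have v0 : v ≠ 0 := by rintro rfl; simp at v1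
      have v3 := (h.div_notMem_iff (div_ne_zero u3 ht) v0).1 v1
      have v4 : 1 + (u - 1) / t / v ∈ X := h.mem_of_sub_one _ (by simpa using v3)
      have v5 : (1 + (u - 1) / t / v) / t ∉ O := fun h' =>
        h.sub_one_div_notMem h' (by simpa using v3)
      have v6 : t * v / t = v := by field_simp
      have v7 : t * v * ((u - 1) / t / v) = u - 1 := by field_simp
      simp [fillOrigin, removeOrigin, u0, u1, u2, v1, v4, v5, v6, v7, ht, v0, hv, u3]
  · simp only [fillOrigin, removeOrigin, u0, u1, u2, SetLike.mem_coe, if_false]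

theorem rightInvOn (h : IsAngularSet O t X) :
    Set.RightInvOn (removeOrigin O t X) (fillOrigin O t X)
      ((O : Set K) ×ˢ (O : Set K)) := by
  rintro ⟨u, v⟩ ⟨hu, hv⟩
  have ht := h.ne_zero
  have h0 := h.zero_notMem
  have h1 := h.one_mem
  simp only [SetLike.mem_coe] at hu hv
  by_cases u0 : u = 0
  · subst u0
    by_cases v0 : v = 0
    · simp [fillOrigin, removeOrigin, v0]
    by_cases vX : v ∈ X
    · have : t * v ≠ 1 := fun h' => h.inv_notMem (by rwa [← eq_inv_of_mul_eq_one_right h'])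
      simp [fillOrigin, removeOrigin, v0, vX, this, ht, hv, h.mul_mem]
    · have v1 : v ≠ 1 := by rintro rfl; exact vX h1
      have v2 : (v - 1) / t ∉ O := fun h' => vX (h.mem_of_sub_one _ h')
      simp [fillOrigin, removeOrigin, v0, vX, v1, v2]
  by_cases u1 : u / t ∈ O
  · by_cases v1 : v = 1
    · have : (1 + u) / t ∉ O := fun h' => h.sub_one_div_notMem h' (by simpa using u1)
      simp [fillOrigin, removeOrigin, u0, u1, v1, this]
    by_cases vX : v ∈ X
    · by_cases v2 : v / t ∈ O
      · have : v / t ∈ X := h.mem_of_mul _ v2 (by rwa [mul_div_cancel₀ _ ht])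
        simp [fillOrigin, removeOrigin, u0, u1, v1, vX, v2, this, mul_div_cancel₀, ht]
      · have v3 := (h.div_mem_or v vX).resolve_left v2
        have v4 := sub_ne_zero.2 v1
        have e : (1 + u * (v - 1) - 1) / t = u / t * (v - 1) := by field_simp; ring
        have e1 : (1 + u * (v - 1) - 1) / t ∈ O := by
          rw [e]; exact O.mul_mem u1 (O.sub_mem hv O.one_mem)
        have e2 : (1 + u * (v - 1)) / t ∉ O := fun h' => h.sub_one_div_notMem h' e1
        have e3 : 1 + u * (v - 1) ≠ 0 := by intro h'; apply e2; simp [h']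
        have e4 : u / t / (u / t * (v - 1)) ∉ O := by
          rw [h.div_notMem_iff (by positivity) (by positivity)]
          convert v3 using 1
          field_simp
        have e5 : t * (u / t) = u := by field_simp
        have e6 : u / t * (v - 1) / (u / t) = v - 1 := by field_simp
        have e7 : 1 + u * (v - 1) ≠ 1 := by simp [u0, v4]
        simp only [fillOrigin, removeOrigin, u0, u1, v1, vX, v2, e, e2, e3, e4, e5, e6, e7,
          e ▸ e1, SetLike.mem_coe, if_true, if_false, ne_eq, not_false_eq_true, and_self,
          add_sub_cancel]
    · simp [fillOrigin, removeOrigin, u0, u1, v1, vX]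
  by_cases u2 : u ≠ 1 ∧ (u - 1) / t ∈ O
  · have u3 := sub_ne_zero.2 u2.1
    have : (u - 1) / t * v / ((u - 1) / t) = v := by field_simp
    simp only [fillOrigin, removeOrigin, u0, u1, u2, this, hv, SetLike.mem_coe, if_true, if_false,
        ne_eq, not_false_eq_true, and_self]
  · simp only [fillOrigin, removeOrigin, u0, u1, u2, SetLike.mem_coe, if_false]

theorem bijOn_fillOrigin (h : IsAngularSet O t X) :
    Set.BijOn (fillOrigin O t X) (((O : Set K) ×ˢ (O : Set K)) \ {(0, 0)})
      ((O : Set K) ×ˢ (O : Set K)) :=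
  Set.InvOn.bijOn ⟨h.leftInvOn, h.rightInvOn⟩ h.mapsTo_fillOrigin h.mapsTo_removeOrigin

end IsAngularSet

section Definability

variable {K : Type*} [Field K] [FirstOrder.Ring.CompatibleRing K] {A : Set K} {α : Type*}

open FirstOrder.Ring FirstOrder.Language

namespace Set

theorem definableFun_realize (τ : Language.ring.Term α) :
    A.DefinableFun Language.ring τ.realize :=
  DefinableFun.of_empty τ.definableFun_realize

theorem DefinableFun.map₂ {f g : (α → K) → K} {op : (Fin 2 → K) → K}
    (hop : A.DefinableFun Language.ring op) (hf : A.DefinableFun Language.ring f)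
    (hg : A.DefinableFun Language.ring g) :
    A.DefinableFun Language.ring fun v => op ![f v, g v] :=
  DefinableFun.comp (g := fun v => ![f v, g v]) (by simp [DefinableMap, hf, hg]) hop

theorem DefinableFun.add {f g : (α → K) → K} (hf : A.DefinableFun Language.ring f)
    (hg : A.DefinableFun Language.ring g) : A.DefinableFun Language.ring fun v => f v + g v := by
  have h (w : Fin 2 → K) : (Term.var 0 + Term.var 1 : Language.ring.Term (Fin 2)).realize w =
      w 0 + w 1 := by simp [Term.realize_var]
  have := (definableFun_realize (A := A) (K := K)
    (Term.var 0 + Term.var 1 : Language.ring.Term (Fin 2))).map₂ hf hg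
  simp only [h] at this
  exact this

theorem DefinableFun.mul {f g : (α → K) → K} (hf : A.DefinableFun Language.ring f)
    (hg : A.DefinableFun Language.ring g) : A.DefinableFun Language.ring fun v => f v * g v := by
  have h (w : Fin 2 → K) : (Term.var 0 * Term.var 1 : Language.ring.Term (Fin 2)).realize w =
      w 0 * w 1 := by simp [Term.realize_var]
  have := (definableFun_realize (A := A) (K := K)
    (Term.var 0 * Term.var 1 : Language.ring.Term (Fin 2))).map₂ hf hg
  simp only [h] at this
  exact this

theorem DefinableFun.sub {f g : (α → K) → K} (hf : A.DefinableFun Language.ring f)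
    (hg : A.DefinableFun Language.ring g) : A.DefinableFun Language.ring fun v => f v - g v := by
  have h (w : Fin 2 → K) : (Term.var 0 + -Term.var 1 : Language.ring.Term (Fin 2)).realize w =
      w 0 - w 1 := by simp [Term.realize_var, sub_eq_add_neg]
  have := (definableFun_realize (A := A) (K := K)
    (Term.var 0 + -Term.var 1 : Language.ring.Term (Fin 2))).map₂ hf hg
  simp only [h] at this
  exact this

theorem definableFun_zero : A.DefinableFun Language.ring fun _ : α → K => (0 : K) := by
  simpa using definableFun_realize (A := A) (K := K) (0 : Language.ring.Term α)

theorem definableFun_one : A.DefinableFun Language.ring fun _ : α → K => (1 : K) := by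
  simpa using definableFun_realize (A := A) (K := K) (1 : Language.ring.Term α)

theorem DefinableFun.pow {f : (α → K) → K} (hf : A.DefinableFun Language.ring f) (n : ℕ) :
    A.DefinableFun Language.ring fun v => f v ^ n := by
  induction n with
  | zero => simpa using definableFun_one
  | succ n ih => simpa only [pow_succ] using ih.mul hf

theorem Definable.ite {p q r : (α → K) → Prop} {_ : DecidablePred p}
    (hp : A.Definable Language.ring {v | p v})
    (hq : A.Definable Language.ring {v | q v}) (hr : A.Definable Language.ring {v | r v}) :
    A.Definable Language.ring {v | if p v then q v else r v} := by
  convert (hp.inter hq).union (hp.compl.inter hr) using 1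
  ext v
  change (if p v then q v else r v) ↔ _
  by_cases h : p v <;> simp [h]

theorem DefinableFun.div {f g : (α → K) → K} (hf : A.DefinableFun Language.ring f)
    (hg : A.DefinableFun Language.ring g) : A.DefinableFun Language.ring fun v => f v / g v := by
  have h : A.DefinableFun Language.ring fun v : Fin 2 → K => v 0 / v 1 := by
    unfold DefinableFun
    have p : ∀ i : Option (Fin 2), A.DefinableFun Language.ring
      fun v : Option (Fin 2) → K => v i := fun i => DefinableFun.proj _
    classical
    convert! Definable.ite ((p (some 1)).ofPred_eq definableFun_zero)
      ((p none).ofPred_eq definableFun_zero)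
      (((p none).mul (p (some 1))).ofPred_eq (p (some 0))) using 1
    ext v
    change v (some 0) / v (some 1) = v none ↔
      if v (some 1) = 0 then v none = 0 else v none * v (some 1) = v (some 0)
    by_cases hv : v (some 1) = 0
    · simp [hv, eq_comm]
    · rw [if_neg hv, div_eq_iff hv, eq_comm]
  exact h.map₂ hf hg

theorem DefinableFun.mem {f : (α → K) → K} (hf : A.DefinableFun Language.ring f)
    {S : Set K} (hS : A.Definable₁ Language.ring S) :
    A.Definable Language.ring {v | f v ∈ S} :=
  Definable.preimage_map (F := fun v (_ : Fin 1) => f v) (fun _ => hf) hS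

theorem Definable₁.exists {S : Set K} {P : K → K → Prop}
    (h : A.Definable Language.ring {v : Fin 1 ⊕ Fin 1 → K | P (v (.inl 0)) (v (.inr 0))})
    (hS : ∀ x, x ∈ S ↔ ∃ y, P x y) : A.Definable₁ Language.ring S := by
  unfold Definable₁
  convert h.exists_of_finite using 1
  ext v
  simp [hS, (Equiv.funUnique (Fin 1) K).symm.exists_congr_left]

theorem definable_graph_fillOrigin {O X : Set K} {t : K} (ht : t ∈ A)
    (hO : A.Definable₁ Language.ring O) (hX : A.Definable₁ Language.ring X) :
    A.Definable Language.ring {v : Fin 4 → K |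
      (v 0, v 1) ∈ (O ×ˢ O) \ {(0, 0)} ∧ fillOrigin O t X (v 0, v 1) = (v 2, v 3)} := by
  have p : ∀ i : Fin 4, A.DefinableFun Language.ring fun v : Fin 4 → K => v i :=
    fun i => DefinableFun.proj _
  have c : A.DefinableFun Language.ring fun _ : Fin 4 → K => t := definableFun_const _ _ ht
  have z : A.DefinableFun Language.ring fun _ : Fin 4 → K => (0 : K) := definableFun_zero
  have o : A.DefinableFun Language.ring fun _ : Fin 4 → K => (1 : K) := definableFun_one
  have eq : ∀ {f g : (Fin 4 → K) → K}, A.DefinableFun Language.ring f →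
      A.DefinableFun Language.ring g →
      A.Definable Language.ring {v | (f v, g v) = (v 2, v 3)} := fun hf hg => by
    simp only [Prod.mk.injEq]
    exact (hf.ofPred_eq (p 2)).inter (hg.ofPred_eq (p 3))
  have q := ((p 0).sub o).div c
  refine .inter (.sdiff (.inter ((p 0).mem hO) ((p 1).mem hO)) ?_) ?_
  · change A.Definable Language.ring {v : Fin 4 → K | (v 0, v 1) = (0, 0)}
    simp only [Prod.mk.injEq]
    exact ((p 0).ofPred_eq z).inter ((p 1).ofPred_eq z)
  change A.Definable Language.ring {v | fillOrigin O t X (v 0, v 1) = (v 2, v 3)}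
  unfold fillOrigin
  have ite_eq (c : Prop) {_ : Decidable c} (a b d : K × K) :
      ((if c then a else b) = d) = if c then a = d else b = d := apply_ite (· = d) c a b
  simp only [ite_eq]
  exact .ite ((p 0).ofPred_eq z)
    (.ite ((p 1).ofPred_eq o) (eq z z)
      (.ite (((p 1).mem hX).inter (((p 1).div c).mem hO)) (eq z ((p 1).div c))
        (.ite ((((p 1).sub o).div c).mem hO) (eq ((p 1).sub o) o) (eq (p 0) (p 1)))))
    (.ite (((p 0).div c).mem hO)
      (.ite ((p 1).mem hX) (eq (p 0) (c.mul (p 1))) (eq (p 0) (p 1)))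
      (.ite (((p 0).ofPred_eq o).compl.inter (q.mem hO))
        (.ite (((p 1).div q).mem hO) (eq (p 0) ((p 1).div q))
          (eq (c.mul (p 1)) (o.add (q.div (p 1)))))
        (eq (p 0) (p 1))))

end Set

end Definability

section Laurent

open HahnSeries

variable {F : Type*} [Field F]

theorem LaurentSeries.mem_range_iff_order_nonneg (x : LaurentSeries F) :
    x ∈ (ofPowerSeries ℤ F).range ↔ 0 ≤ x.order := by
  constructor
  · rintro ⟨p, rfl⟩
    by_contra! h
    have hp : (p : LaurentSeries F) ≠ 0 := by
      intro h0; simp [h0] at h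
    exact coeff_order_eq_zero.not.2 hp (by rw [PowerSeries.coeff_coe, if_pos h])
  · intro h
    obtain ⟨n, hn⟩ := Int.eq_ofNat_of_zero_le h
    exact ⟨_, LaurentSeries.X_order_mul_powerSeriesPart hn.symm⟩

theorem LaurentSeries.leadingCoeff_pow (x : LaurentSeries F) (n : ℕ) :
    (x ^ n).leadingCoeff = x.leadingCoeff ^ n := by
  induction n with
  | zero => simp
  | succ n ih => rw [pow_succ, HahnSeries.leadingCoeff_mul, ih, pow_succ]

theorem LaurentSeries.order_add_one {y : LaurentSeries F} (hy : y.order < 0) :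
    (y + 1).order = y.order := by
  have hy0 : y ≠ 0 := by rintro rfl; simp at hy
  have h : (y + 1).coeff y.order ≠ 0 := by
    simp [coeff_one, hy.ne, hy0]
  refine le_antisymm (order_le_of_coeff_ne_zero h) ?_
  refine le_trans ?_ (min_order_le_order_add (ne_zero_of_coeff_ne_zero h))
  simp [hy.le]

theorem LaurentSeries.mem_range_iff_exists_quadratic (x : LaurentSeries F) :
    x ∈ (ofPowerSeries ℤ F).range ↔
      ∃ y : LaurentSeries F, y ^ 2 + y = single (1 : ℤ) (1 : F) * x ^ 2 := by
  constructor
  · rintro ⟨p, rfl⟩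
    obtain ⟨a, ha, -⟩ := HenselianRing.is_henselian
      (I := Ideal.span {(PowerSeries.X : PowerSeries F)})
      (Polynomial.X ^ 2 + Polynomial.X - Polynomial.C (PowerSeries.X * p ^ 2)) (by monicity!) 0
      (by simpa using Ideal.mul_mem_right _ _ (Ideal.mem_span_singleton_self _)) (by simp)
    refine ⟨a, ?_⟩
    simp only [Polynomial.IsRoot, Polynomial.eval_sub, Polynomial.eval_add, Polynomial.eval_pow,
      Polynomial.eval_X, Polynomial.eval_C, sub_eq_zero] at ha
    rw [← ofPowerSeries_X (Γ := ℤ), ← map_pow, ← map_pow, ← map_add, ha, map_mul]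
  · rintro ⟨y, hy⟩
    rw [mem_range_iff_order_nonneg]
    by_contra! hx
    have hx0 : x ≠ 0 := by rintro rfl; simp at hx
    have ho : (y ^ 2 + y).order = 1 + 2 * x.order := by
      rw [hy, order_mul (by simp) (pow_ne_zero 2 hx0), order_single one_ne_zero, order_pow]
      simp
    by_cases hy0 : 0 ≤ y.order
    · rw [← mem_range_iff_order_nonneg] at hy0
      have := (mem_range_iff_order_nonneg _).1 (add_mem (pow_mem hy0 2) hy0)
      lia
    · push Not at hy0
      have h1 : y ≠ 0 := by rintro rfl; simp at hy0
      have h2 : y + 1 ≠ 0 := by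
        intro h
        have := order_add_one hy0
        simp only [h, order_zero] at this
        lia
      rw [show y ^ 2 + y = y * (y + 1) by ring, order_mul h1 h2, order_add_one hy0] at ho
      lia

theorem LaurentSeries.ofPowerSeries_X_mul_div_single (p : PowerSeries F) :
    ofPowerSeries ℤ F (PowerSeries.X * p) / single (1 : ℤ) (1 : F) = ofPowerSeries ℤ F p := by
  rw [map_mul, ofPowerSeries_X, mul_div_cancel_left₀ _ (by simp)]

theorem LaurentSeries.leadingCoeff_eq_one_of_sub_one_div {x : LaurentSeries F}
    (h : (x - 1) / single (1 : ℤ) (1 : F) ∈ (ofPowerSeries ℤ F).range) :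
    x.leadingCoeff = 1 := by
  obtain ⟨p, hp⟩ := h
  rw [eq_div_iff (by simp), ← ofPowerSeries_X (Γ := ℤ), ← map_mul, eq_sub_iff_add_eq,
    ← map_one (ofPowerSeries ℤ F), ← map_add] at hp
  have h0 : x.coeff 0 = 1 := by
    rw [← hp, ← Nat.cast_zero, LaurentSeries.coeff_coe_powerSeries]
    simp
  have h1 : 0 ≤ x.order := (mem_range_iff_order_nonneg x).1 ⟨_, hp⟩
  have h2 : x.order ≤ 0 := order_le_of_coeff_ne_zero (by simp [h0])
  rw [leadingCoeff_eq, le_antisymm h2 h1, h0]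

theorem LaurentSeries.leadingCoeff_powerSeries {p : PowerSeries F}
    (h : PowerSeries.constantCoeff p ≠ 0) :
    (ofPowerSeries ℤ F p).leadingCoeff = PowerSeries.constantCoeff p := by
  have h0 : (ofPowerSeries ℤ F p).coeff 0 = PowerSeries.constantCoeff p := by
    rw [← Nat.cast_zero, LaurentSeries.coeff_coe_powerSeries]
    simp
  have h1 : 0 ≤ (ofPowerSeries ℤ F p).order := (mem_range_iff_order_nonneg _).1 ⟨_, rfl⟩
  have h2 : (ofPowerSeries ℤ F p).order ≤ 0 := order_le_of_coeff_ne_zero (by simp [h0, h])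
  rw [leadingCoeff_eq, le_antisymm h2 h1, h0]

theorem LaurentSeries.sub_one_div_of_constantCoeff {p : PowerSeries F}
    (h : PowerSeries.constantCoeff p = 1) :
    (ofPowerSeries ℤ F p - 1) / single (1 : ℤ) (1 : F) ∈ (ofPowerSeries ℤ F).range := by
  obtain ⟨r, hr⟩ : PowerSeries.X ∣ p - 1 := by simp [PowerSeries.X_dvd_iff, h]
  exact ⟨r, by rw [← ofPowerSeries_X_mul_div_single, ← hr, map_sub, map_one]⟩

theorem LaurentSeries.leadingCoeff_eq_one_iff [Fintype F] (x : LaurentSeries F) :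
    x.leadingCoeff = 1 ↔ ∃ i : Fin (Fintype.card F - 1), x ≠ 0 ∧ ∃ z : LaurentSeries F,
      (x / (single (1 : ℤ) (1 : F) ^ (i : ℕ) * z ^ (Fintype.card F - 1)) - 1) /
        single (1 : ℤ) (1 : F) ∈ (ofPowerSeries ℤ F).range := by
  have hq : 0 < Fintype.card F - 1 := Nat.sub_pos_of_lt Fintype.one_lt_card
  set q := Fintype.card F - 1 with hq'
  constructor
  · intro h
    have hx : x ≠ 0 := by rintro rfl; simp at h
    have hq0 : (q : ℤ) ≠ 0 := by lia
    have hlt := Int.emod_lt_of_pos x.order (show (0 : ℤ) < q by lia)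
    have hnn := Int.emod_nonneg x.order hq0
    refine ⟨⟨(x.order % q).toNat, by lia⟩, hx, single (x.order / q) 1, ?_⟩
    have e : single (1 : ℤ) (1 : F) ^ (x.order % q).toNat * single (x.order / q) 1 ^ q =
        single x.order 1 := by
      rw [single_pow, single_pow, single_mul_single]
      congr 1
      · simp only [nsmul_eq_mul, mul_one, Int.toNat_of_nonneg hnn]
        rw [Int.emod_add_mul_ediv]
      · simp
    have e' : x / single x.order 1 = ofPowerSeries ℤ F x.powerSeriesPart := by
      rw [div_eq_iff (by simp), mul_comm, single_order_mul_powerSeriesPart]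
    simp only [e, e']
    refine sub_one_div_of_constantCoeff ?_
    rw [← PowerSeries.coeff_zero_eq_constantCoeff_apply, powerSeriesPart_coeff, ← h,
      leadingCoeff_eq]
    simp
  · rintro ⟨i, hx, z, h⟩
    have h1 := leadingCoeff_eq_one_of_sub_one_div h
    set d := single (1 : ℤ) (1 : F) ^ (i : ℕ) * z ^ q with hd
    have hd0 : d ≠ 0 := by
      intro h0
      simp [h0] at h1
    have hz : z ≠ 0 := by
      rintro rfl
      exact hd0 (by simp [hd, hq.ne'])
    rw [← div_mul_cancel₀ x hd0, HahnSeries.leadingCoeff_mul, h1, hd, HahnSeries.leadingCoeff_mul,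
      leadingCoeff_pow, leadingCoeff_pow, leadingCoeff_of_single,
      FiniteField.pow_card_sub_one_eq_one _ (leadingCoeff_ne_zero.2 hz)]
    simp

theorem LaurentSeries.isAngularSet :
    IsAngularSet (ofPowerSeries ℤ F).range (single (1 : ℤ) (1 : F))
      {x | x ∈ (ofPowerSeries ℤ F).range ∧ x.leadingCoeff = 1} where
  mem := ⟨PowerSeries.X, ofPowerSeries_X⟩
  inv_notMem := by
    rw [mem_range_iff_order_nonneg, inv_single, order_single (by simp)]
    simp
  mem_or_inv_mem x := by
    rw [mem_range_iff_order_nonneg, or_iff_not_imp_left, mem_range_iff_order_nonneg]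
    intro h
    have hx : x ≠ 0 := by rintro rfl; simp at h
    have ht : single (1 : ℤ) (1 : F) ≠ 0 := by simp
    have h1 := order_mul ht hx
    have h2 := order_mul (mul_ne_zero ht hx) (inv_ne_zero (mul_ne_zero ht hx))
    rw [mul_inv_cancel₀ (mul_ne_zero ht hx), order_one] at h2
    rw [order_single one_ne_zero] at h1
    lia
  subset x hx := hx.1
  zero_notMem := by simp
  mem_of_sub_one x hx := by
    refine ⟨?_, leadingCoeff_eq_one_of_sub_one_div hx⟩
    obtain ⟨p, hp⟩ := hx
    rw [eq_div_iff (by simp), ← ofPowerSeries_X (Γ := ℤ), ← map_mul, eq_sub_iff_add_eq,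
      ← map_one (ofPowerSeries ℤ F), ← map_add] at hp
    exact ⟨_, hp⟩
  div_mem_or := by
    rintro x ⟨⟨p, rfl⟩, hx⟩
    by_cases h : PowerSeries.constantCoeff p = 0
    · obtain ⟨r, rfl⟩ := PowerSeries.X_dvd_iff.2 h
      exact .inl ⟨r, (ofPowerSeries_X_mul_div_single r).symm⟩
    · exact .inr (sub_one_div_of_constantCoeff (by rw [← leadingCoeff_powerSeries h, hx]))
  mul_mem x hx := ⟨mul_mem ⟨PowerSeries.X, ofPowerSeries_X⟩ hx.1, by
    rw [HahnSeries.leadingCoeff_mul, leadingCoeff_of_single, one_mul, hx.2]⟩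
  mem_of_mul x hx h := ⟨hx, by
    simpa only [HahnSeries.leadingCoeff_mul, leadingCoeff_of_single, one_mul] using h.2⟩

section

variable [FirstOrder.Ring.CompatibleRing (LaurentSeries F)]

theorem LaurentSeries.definable_range :
    Set.Definable₁ ({single (1 : ℤ) (1 : F)} : Set (LaurentSeries F)) Language.ring
      ((ofPowerSeries ℤ F).range : Set (LaurentSeries F)) := by
  refine .exists (P := fun x y => y ^ 2 + y = single (1 : ℤ) (1 : F) * x ^ 2) ?_
    mem_range_iff_exists_quadratic
  exact (((Set.DefinableFun.proj _).pow 2).add (Set.DefinableFun.proj _)).ofPred_eq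
    ((Language.definableFun_const _ _ (Set.mem_singleton _)).mul ((Set.DefinableFun.proj _).pow 2))

theorem LaurentSeries.definable_leadingCoeff_eq_one [Fintype F] :
    Set.Definable₁ ({single (1 : ℤ) (1 : F)} : Set (LaurentSeries F)) Language.ring
      {x | x ∈ (ofPowerSeries ℤ F).range ∧ x.leadingCoeff = 1} := by
  refine Set.Definable.inter definable_range ?_
  simp only [leadingCoeff_eq_one_iff]
  change Set.Definable _ _ {v : Fin 1 → LaurentSeries F | ∃ i, _}
  rw [Set.ofPred_exists]
  refine Set.definable_iUnion_of_finite fun i => .inter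
    ((Set.DefinableFun.proj _).ofPred_eq Set.definableFun_zero).compl ?_
  refine Set.Definable₁.exists (S := {x | ∃ z, _})
    (P := fun x z => (x / (single (1 : ℤ) (1 : F) ^ (i : ℕ) * z ^ (Fintype.card F - 1)) - 1) /
      single (1 : ℤ) (1 : F) ∈ (ofPowerSeries ℤ F).range) ?_
    fun x => Iff.rfl
  have c : Set.DefinableFun Language.ring ({single (1 : ℤ) (1 : F)} : Set (LaurentSeries F))
      fun _ : Fin 1 ⊕ Fin 1 → LaurentSeries F => single (1 : ℤ) (1 : F) :=
    Language.definableFun_const _ _ rfl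
  exact ((((Set.DefinableFun.proj _).div ((c.pow _).mul ((Set.DefinableFun.proj _).pow _))).sub
    Set.definableFun_one).div c).mem definable_range

end

end Laurent

theorem exists_definable_bij_plane_minus_point_laurent (F : Type*) [Field F] [Fintype F] :
    ∃ f : LaurentSeries F × LaurentSeries F → LaurentSeries F × LaurentSeries F,
      Set.BijOn f
        ((Set.range (HahnSeries.ofPowerSeries ℤ F) ×ˢ
            Set.range (HahnSeries.ofPowerSeries ℤ F)) \ {(0, 0)})
        (Set.range (HahnSeries.ofPowerSeries ℤ F) ×ˢ
          Set.range (HahnSeries.ofPowerSeries ℤ F)) ∧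
      Set.Definable ({HahnSeries.single (1 : ℤ) (1 : F)} : Set (LaurentSeries F))
        Language.ring
        {v : Fin 4 → LaurentSeries F |
          (v 0, v 1) ∈
              (Set.range (HahnSeries.ofPowerSeries ℤ F) ×ˢ
                Set.range (HahnSeries.ofPowerSeries ℤ F)) \ {(0, 0)} ∧
            f (v 0, v 1) = (v 2, v 3)} := by
  rw [← RingHom.coe_range]
  exact ⟨_, LaurentSeries.isAngularSet.bijOn_fillOrigin,
    Set.definable_graph_fillOrigin rfl LaurentSeries.definable_range
      LaurentSeries.definable_leadingCoeff_eq_one⟩
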